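/- An FO sentence φ (over an arbitrary finite vocabulary) is preserved under substructures modulo a finite core if and only if φ is logically equivalent to a Σ⁰₂ sentence, i.e., a prenex sentence of the form ∃x₁…∃x_B ∀y₁…∀y_n β with β quantifier-free. -/

import Mathlib

open FirstOrder Language

universe u v

namespace Stmt

variable {L : FirstOrder.Language.{u, v}}

/-- Universally quantify the last `k` bound variables of a bounded formula. -/
def allsK {n : ℕ} : (k : ℕ) → L.BoundedFormula Empty (n + k) → L.BoundedFormula Empty n
  | 0, φ => φ
  | k + 1, φ => allsK k φ.all

/-- Existentially quantify the last `k` bound variables of a bounded formula. -/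
def exsK {n : ℕ} : (k : ℕ) → L.BoundedFormula Empty (n + k) → L.BoundedFormula Empty n
  | 0, φ => φ
  | k + 1, φ => exsK k φ.ex

/-- The Σ⁰₂ sentence `∃x₁…x_B ∀y₁…y_n β` (for `β` quantifier-free). -/
def sigma2 (B n : ℕ) (β : L.BoundedFormula Empty (B + n)) : L.Sentence :=
  (allsK n β).exs

/-- The Π⁰₂ sentence `∀x₁…x_k ∃y₁…y_m β` (for `β` quantifier-free). -/
def pi2 (k m : ℕ) (β : L.BoundedFormula Empty (k + m)) : L.Sentence :=
  (exsK m β).alls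

/-- `C` is a core of the structure `M` w.r.t. `φ`: every (nonempty) substructure of `M`
whose universe contains `C` satisfies `φ`. -/
def IsCore (φ : L.Sentence) (M : Type max u v) [L.Structure M] (C : Set M) : Prop :=
  ∀ N : L.Substructure M, C ⊆ (N : Set M) → Nonempty N → ↥N ⊨ φ

/-- `φ` is preserved under substructures modulo a finite core: every model of `φ`
has a finite core w.r.t. `φ`. -/
def PSCf (φ : L.Sentence) : Prop :=
  ∀ (M : Type max u v) [L.Structure M] [Nonempty M],
    M ⊨ φ → ∃ C : Set M, C.Finite ∧ IsCore φ M C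

/-- `φ ∈ PSC(B)`: every model of `φ` has a core of size at most `B` w.r.t. `φ`. -/
def PSC (φ : L.Sentence) (B : ℕ) : Prop :=
  ∀ (M : Type max u v) [L.Structure M] [Nonempty M],
    M ⊨ φ → ∃ C : Finset M, C.card ≤ B ∧ IsCore φ M ↑C

/-- Logical equivalence of sentences: they hold in exactly the same (nonempty) structures. -/
def Equiv (φ ψ : L.Sentence) : Prop :=
  ∀ (M : Type max u v) [L.Structure M] [Nonempty M], M ⊨ φ ↔ M ⊨ ψ

section aux

theorem allsK_realize {M : Type*} [L.Structure M] {n : ℕ} (k : ℕ)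
    (φ : L.BoundedFormula Empty (n + k)) (v : Empty → M) (x : Fin n → M) :
    (allsK k φ).Realize v x ↔ ∀ y : Fin k → M, φ.Realize v (Fin.append x y) := by
  induction k with
  | zero =>
    constructor
    · intro h y
      have : Fin.append x y = x := by
        funext i
        exact Fin.append_left x y i
      rw [this]; exact h
    · intro h
      have := h Fin.elim0
      have e : Fin.append x Fin.elim0 = x := by
        funext i
        exact Fin.append_left x _ i
      rw [e] at this; exact this
  | succ k ih =>
    rw [allsK, ih]
    constructor
    · intro h y
      have := h (Fin.init y) (y (Fin.last k))
      rw [← Fin.append_snoc, Fin.snoc_init_self] at this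
      exact this
    · intro h y a
      have := h (Fin.snoc y a)
      rw [Fin.append_snoc] at this
      exact this

theorem sigma2_realize {M : Type*} [L.Structure M] (B n : ℕ)
    (β : L.BoundedFormula Empty (B + n)) :
    M ⊨ sigma2 B n β ↔ ∃ x : Fin B → M, ∀ y : Fin n → M,
      β.Realize default (Fin.append x y) := by
  rw [sigma2, Sentence.Realize, BoundedFormula.realize_exs]
  simp only [allsK_realize]

theorem easy (φ : L.Sentence) (B n : ℕ) (β : L.BoundedFormula Empty (B + n)) (hβ : β.IsQF)
    (h : Equiv φ (sigma2 B n β)) : PSCf φ := by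
  intro M _ _ hM
  rw [h M, sigma2_realize] at hM
  obtain ⟨x, hx⟩ := hM
  refine ⟨Set.range x, Set.finite_range x, ?_⟩
  intro N hN hne
  rw [h N, sigma2_realize]
  refine ⟨fun i => ⟨x i, hN ⟨i, rfl⟩⟩, fun y => ?_⟩
  rw [← hβ.realize_embedding N.subtype]
  rw [show (N.subtype ∘ (default : Empty → N)) = default from Subsingleton.elim _ _]
  convert hx (fun i => (y i : M)) using 1
  · funext i
    refine Fin.addCases (fun i => ?_) (fun i => ?_) i <;> simp

/-- Conjunction of the first `k` formulas. -/
def cnj {α : Type} (ψ : ℕ → L.Formula α) : ℕ → L.Formula α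
  | 0 => ⊤
  | k + 1 => cnj ψ k ⊓ ψ k

theorem cnj_realize {α : Type} (ψ : ℕ → L.Formula α) (k : ℕ) {M : Type*} [L.Structure M]
    (v : α → M) : (cnj ψ k).Realize v ↔ ∀ i < k, (ψ i).Realize v := by
  induction k with
  | zero => simp [cnj]
  | succ k ih =>
    rw [cnj, Formula.realize_inf, ih]
    constructor
    · rintro ⟨h1, h2⟩ i hi
      rcases Nat.lt_succ_iff_lt_or_eq.1 hi with h | rfl
      · exact h1 i h
      · exact h2
    · intro h
      exact ⟨fun i hi => h i (by omega), h k (by omega)⟩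

theorem cnj_qf {α : Type} (ψ : ℕ → L.Formula α) (h : ∀ i, (ψ i).IsQF) (k : ℕ) :
    (cnj ψ k).IsQF := by
  induction k with
  | zero => exact BoundedFormula.IsQF.top
  | succ k ih => exact ih.inf (h k)

/-- Semantic Sigma2 property. -/
def E (ψ : L.Formula (ℕ ⊕ ℕ)) (M : Type max u v) [L.Structure M] : Prop :=
  ∃ x : ℕ → M, ∀ w : ℕ → M, ψ.Realize (Sum.elim x w)

theorem term_loc (t : L.Term ((ℕ ⊕ ℕ) ⊕ Fin 0)) : ∃ n0 : ℕ, ∀ (M : Type max u v) [L.Structure M]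
    (v v' : ℕ ⊕ ℕ → M) (z : Fin 0 → M),
    (∀ i < n0, v (.inl i) = v' (.inl i) ∧ v (.inr i) = v' (.inr i)) →
    t.realize (Sum.elim v z) = t.realize (Sum.elim v' z) := by
  induction t with
  | var a =>
    rcases a with (a | a) | a
    · exact ⟨a + 1, fun M _ v v' z h => (h a (by omega)).1⟩
    · exact ⟨a + 1, fun M _ v v' z h => (h a (by omega)).2⟩
    · exact a.elim0
  | func f ts ih =>
    choose n hn using ih
    refine ⟨Finset.univ.sup n, fun M _ v v' z h => ?_⟩
    simp only [Term.realize]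
    congr 1
    funext j
    exact hn j M v v' z fun i hi =>
      h i (lt_of_lt_of_le hi (Finset.le_sup (f := n) (Finset.mem_univ j)))

theorem qf_loc (ψ : L.Formula (ℕ ⊕ ℕ)) (h : ψ.IsQF) : ∃ n0 : ℕ, ∀ (M : Type max u v) [L.Structure M]
    (v v' : ℕ ⊕ ℕ → M),
    (∀ i < n0, v (.inl i) = v' (.inl i) ∧ v (.inr i) = v' (.inr i)) →
    (ψ.Realize v ↔ ψ.Realize v') := by
  induction h with
  | falsum => exact ⟨0, fun M _ v v' _ => Iff.rfl⟩
  | of_isAtomic h =>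
    cases h with
    | equal t₁ t₂ =>
      obtain ⟨n₁, h₁⟩ := term_loc t₁
      obtain ⟨n₂, h₂⟩ := term_loc t₂
      refine ⟨max n₁ n₂, fun M _ v v' h => ?_⟩
      rw [Formula.Realize, Formula.Realize, BoundedFormula.realize_bdEqual,
        BoundedFormula.realize_bdEqual, h₁ M v v' _ fun i hi => h i (by omega),
        h₂ M v v' _ fun i hi => h i (by omega)]
    | rel R ts =>
      choose n hn using fun j => term_loc (ts j)
      refine ⟨Finset.univ.sup n, fun M _ v v' h => ?_⟩
      rw [Formula.Realize, Formula.Realize, BoundedFormula.realize_rel,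
        BoundedFormula.realize_rel]
      refine iff_of_eq (congrArg _ (funext fun j => ?_))
      exact hn j M v v' _ fun i hi =>
        h i (lt_of_lt_of_le hi (Finset.le_sup (f := n) (Finset.mem_univ j)))
  | imp _ _ ih₁ ih₂ =>
    obtain ⟨n₁, h₁⟩ := ih₁
    obtain ⟨n₂, h₂⟩ := ih₂
    refine ⟨max n₁ n₂, fun M _ v v' h => ?_⟩
    exact imp_congr (h₁ M v v' fun i hi => h i (by omega)) (h₂ M v v' fun i hi => h i (by omega))

theorem E_sigma2 (ψ : L.Formula (ℕ ⊕ ℕ)) (h : ψ.IsQF) :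
    ∃ (B n : ℕ) (β : L.BoundedFormula Empty (B + n)), β.IsQF ∧
      ∀ (M : Type max u v) [L.Structure M], E ψ M ↔ M ⊨ sigma2 B n β := by
  obtain ⟨n0, hn⟩ := qf_loc ψ h
  let g : ℕ ⊕ ℕ → Empty ⊕ Fin ((n0 + 1) + (n0 + 1)) := fun s =>
    Sum.inr (Sum.elim (fun i => Fin.castAdd (n0 + 1) (Fin.ofNat (n0 + 1) i))
      (fun i => Fin.natAdd (n0 + 1) (Fin.ofNat (n0 + 1) i)) s)
  let β : L.BoundedFormula Empty ((n0 + 1) + (n0 + 1)) := BoundedFormula.relabel g ψ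
  have key : ∀ (M : Type max u v) [L.Structure M] (x y : Fin (n0 + 1) → M),
      β.Realize default (Fin.append x y) ↔
        ψ.Realize (Sum.elim (fun i => x (Fin.ofNat (n0 + 1) i))
          (fun i => y (Fin.ofNat (n0 + 1) i))) := by
    intro M _ x y
    have := BoundedFormula.realize_relabel (φ := ψ) (g := g) (v := (default : Empty → M))
      (xs := (show Fin ((n0 + 1) + (n0 + 1) + 0) → M from
        (Fin.append x y : Fin ((n0 + 1) + (n0 + 1)) → M)))
    refine this.trans ?_
    rw [Formula.Realize]
    refine iff_of_eq (congrArg₂ _ ?_ (Subsingleton.elim _ _))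
    funext s
    rcases s with s | s
    · exact Fin.append_left x y _
    · exact Fin.append_right x y _
  refine ⟨n0 + 1, n0 + 1, β, BoundedFormula.IsQF.relabel h g, fun M _ => ?_⟩
  rw [sigma2_realize]
  have hv : ∀ i < n0, ((Fin.ofNat (n0 + 1) i : Fin (n0 + 1)) : ℕ) = i := by
    intro i hi
    simp only [Fin.val_ofNat]
    exact Nat.mod_eq_of_lt (by omega)
  constructor
  · rintro ⟨x, hx⟩
    refine ⟨fun i => x i, fun y => ?_⟩
    rw [key]
    refine (hn M _ _ ?_).1 (hx fun i => y (Fin.ofNat (n0 + 1) i))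
    intro i hi
    simp only [Sum.elim_inl, Sum.elim_inr, hv i hi, and_self]
  · rintro ⟨x, hx⟩
    refine ⟨fun i => x (Fin.ofNat (n0 + 1) i), fun w => ?_⟩
    have := hx (fun i => w i)
    rw [key] at this
    refine (hn M _ _ ?_).1 this
    intro i hi
    simp only [Sum.elim_inl, Sum.elim_inr, hv i hi, and_self]

/-- The ultrafilter used. -/
noncomputable abbrev U : Ultrafilter ℕ := Filter.hyperfilter ℕ

theorem ev_ge (k : ℕ) : ∀ᶠ i in (U : Filter ℕ), k ≤ i :=
  Nat.hyperfilter_le_atTop (Filter.eventually_ge_atTop k)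

/-- quotient map -/
noncomputable def mkU {M : ℕ → Type*} (x : ∀ i, M i) : (U : Filter ℕ).Product M :=
  (Quotient.mk _ x : Quotient ((U : Filter ℕ).productSetoid M))

/-- Łoś for a pair of valuations -/
theorem los {M : ℕ → Type max u v} [∀ i, L.Structure (M i)] [∀ i, Nonempty (M i)]
    (ψ : L.Formula (ℕ ⊕ ℕ)) (c w : ℕ → ∀ i, M i) :
    ψ.Realize (Sum.elim (fun b => mkU (c b))
      (fun b => mkU (w b))) ↔
    ∀ᶠ i in (U : Filter ℕ), ψ.Realize (Sum.elim (fun b => c b i) (fun b => w b i)) := by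
  have := Ultraproduct.realize_formula_cast (u := U) (M := M) ψ (Sum.elim c w)
  have e1 : Sum.elim (fun b => mkU (c b)) (fun b => mkU (w b)) = fun s => mkU (Sum.elim c w s) := by
    funext s
    cases s <;> rfl
  have e2 : ∀ i, Sum.elim (fun b => c b i) (fun b => w b i) = fun s => Sum.elim c w s i := by
    intro i
    funext s
    cases s <;> rfl
  rw [e1]
  simp only [e2]
  exact this

theorem prod_lift {M : ℕ → Type*} (c : ℕ → (U : Filter ℕ).Product M) :
    ∃ c' : ℕ → ∀ i, M i, c = fun b => mkU (c' b) := by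
  refine ⟨fun b => (c b).out, ?_⟩
  funext b
  exact (Quotient.out_eq (c b)).symm

theorem saturation {M : ℕ → Type max u v} [∀ i, L.Structure (M i)] [∀ i, Nonempty (M i)]
    (δ : ℕ → L.Formula (ℕ ⊕ ℕ)) (c : ℕ → (U : Filter ℕ).Product M)
    (h : ∀ k, ∃ w, (cnj δ k).Realize (Sum.elim c w)) :
    ∃ w, ∀ k, (δ k).Realize (Sum.elim c w) := by
  classical
  obtain ⟨c, rfl⟩ := prod_lift c
  let P : ℕ → ℕ → Prop := fun i k => ∃ w : ℕ → M i, (cnj δ k).Realize (Sum.elim (fun b => c b i) w)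
  have hP : ∀ k, ∀ᶠ i in (U : Filter ℕ), P i k := by
    intro k
    obtain ⟨w, hw⟩ := h k
    obtain ⟨w, rfl⟩ := prod_lift w
    rw [los] at hw
    filter_upwards [hw] with i hi using ⟨_, hi⟩
  let W : ∀ i, ℕ → M i := fun i =>
    if h : P i (Nat.findGreatest (P i) i) then h.choose else fun _ => Classical.arbitrary _
  refine ⟨fun b => mkU (fun i => W i b), fun k => ?_⟩
  rw [los]
  filter_upwards [hP (k + 1), ev_ge (k + 1)] with i hi hk
  have h1 := Nat.findGreatest_spec hk hi
  have h2 := Nat.le_findGreatest hk hi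
  have h3 : (cnj δ (Nat.findGreatest (P i) i)).Realize (Sum.elim (fun b => c b i) (W i)) := by
    simp only [W, dif_pos h1]
    exact h1.choose_spec
  exact (cnj_realize _ _ _).1 h3 k (by omega)

/-- embedding from equality of quantifier-free types -/
theorem embed {A M : Type max u v} [L.Structure A] [L.Structure M] (v : ℕ ⊕ ℕ → A)
    (w : ℕ ⊕ ℕ → M) (hv : Function.Surjective v)
    (h : ∀ ψ : L.Formula (ℕ ⊕ ℕ), ψ.IsQF → ψ.Realize v → ψ.Realize w) :
    ∃ f : A ↪[L] M, ∀ s, f (v s) = w s := by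
  have h' : ∀ ψ : L.Formula (ℕ ⊕ ℕ), ψ.IsQF → (ψ.Realize v ↔ ψ.Realize w) := by
    intro ψ hψ
    refine ⟨h ψ hψ, fun hw => ?_⟩
    by_contra hn
    exact h ψ.not hψ.not hn hw
  have heq : ∀ t₁ t₂ : L.Term (ℕ ⊕ ℕ), t₁.realize v = t₂.realize v ↔
      t₁.realize w = t₂.realize w := by
    intro t₁ t₂
    have := h' (t₁.equal t₂) (BoundedFormula.IsAtomic.equal _ _).isQF
    simpa only [Formula.realize_equal] using this
  choose r hr using hv
  have hF : ∀ s, w (r (v s)) = w s := fun s =>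
    (heq (Term.var (r (v s))) (Term.var s)).1 (hr (v s))
  refine ⟨⟨⟨fun a => w (r a), ?_⟩, ?_, ?_⟩, hF⟩
  · intro a b hab
    have := (heq (Term.var (r a)) (Term.var (r b))).2 hab
    simpa [hr] using this
  · intro n f x
    have := (heq (Term.var (r (Structure.funMap f x))) (Term.func f fun i => Term.var (r (x i)))).1
      (by simp [hr])
    simp only [Term.realize_var, Term.realize_func] at this
    exact this
  · intro n R x
    have := h' (R.formula fun i => Term.var (r (x i))) (BoundedFormula.IsAtomic.rel _ _).isQF
    simp only [Formula.realize_rel, Term.realize_var, hr] at this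
    exact this.symm

theorem exists_countable [Countable L.Symbols] (M : Type max u v) [L.Structure M] [Nonempty M]
    (c : ℕ → M) :
    ∃ S : L.ElementarySubstructure M, Set.range c ⊆ S ∧ Countable S := by
  rcases le_or_gt Cardinal.aleph0 (Cardinal.mk M) with hM | hM
  · obtain ⟨S, h1, h2⟩ := exists_elementarySubstructure_card_eq (L := L) (M := M) (Set.range c)
      (Cardinal.aleph0 : Cardinal.{max u v}) le_rfl
      (by simpa using (Set.countable_range c).le_aleph0) (by
        have : L.card ≤ Cardinal.aleph0 := Cardinal.mk_le_aleph0
        simpa only [Cardinal.lift_aleph0, Cardinal.lift_le_aleph0] using this) (by simpa using hM)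
    refine ⟨S, h1, ?_⟩
    rw [← Cardinal.mk_le_aleph0_iff]
    simpa using h2.le
  · refine ⟨⊤, fun _ _ => trivial, ?_⟩
    have : Countable M := Cardinal.mk_le_aleph0_iff.1 hM.le
    infer_instance


/-- disjunctions -/
def orr (A B : L.Formula (ℕ ⊕ ℕ)) : L.Formula (ℕ ⊕ ℕ) :=
  A.relabel (Sum.map (2 * ·) (2 * ·)) ⊔ B.relabel (Sum.map (2 * · + 1) (2 * · + 1))

theorem orr_qf {A B : L.Formula (ℕ ⊕ ℕ)} (hA : A.IsQF) (hB : B.IsQF) : (orr A B).IsQF :=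
  (BoundedFormula.IsQF.relabel hA _).sup (BoundedFormula.IsQF.relabel hB _)

theorem orr_E (A B : L.Formula (ℕ ⊕ ℕ)) (M : Type max u v) [L.Structure M] :
    E (orr A B) M ↔ E A M ∨ E B M := by
  have key : ∀ x w : ℕ → M, (orr A B).Realize (Sum.elim x w) ↔
      A.Realize (Sum.elim (fun i => x (2 * i)) (fun i => w (2 * i))) ∨
      B.Realize (Sum.elim (fun i => x (2 * i + 1)) (fun i => w (2 * i + 1))) := by
    intro x w
    rw [orr, Formula.realize_sup, Formula.realize_relabel, Formula.realize_relabel,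
      Sum.elim_comp_map, Sum.elim_comp_map]
    rfl
  constructor
  · rintro ⟨x, hx⟩
    by_contra hn
    simp only [E, not_or, not_exists, not_forall] at hn
    obtain ⟨h1, h2⟩ := hn
    obtain ⟨w1, h1⟩ := h1 fun i => x (2 * i)
    obtain ⟨w2, h2⟩ := h2 fun i => x (2 * i + 1)
    have := (key x fun i => if i % 2 = 0 then w1 (i / 2) else w2 (i / 2)).1 (hx _)
    have e1 : (fun i : ℕ => (if 2 * i % 2 = 0 then w1 (2 * i / 2) else w2 (2 * i / 2))) = w1 := by
      funext i
      simp
    have e2 : (fun i : ℕ => (if (2 * i + 1) % 2 = 0 then w1 ((2 * i + 1) / 2)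
        else w2 ((2 * i + 1) / 2))) = w2 := by
      funext i
      rw [if_neg (by omega), show (2 * i + 1) / 2 = i by omega]
    rw [e1, e2] at this
    exact this.elim h1 h2
  · rintro (⟨x, hx⟩ | ⟨x, hx⟩)
    · refine ⟨fun i => x (i / 2), fun w => (key _ _).2 (Or.inl ?_)⟩
      simpa using hx fun i => w (2 * i)
    · refine ⟨fun i => x (i / 2), fun w => (key _ _).2 (Or.inr ?_)⟩
      have : (fun i : ℕ => x ((2 * i + 1) / 2)) = x := by
        funext i
        rw [show (2 * i + 1) / 2 = i by omega]
      rw [this]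
      exact hx fun i => w (2 * i + 1)

/-- Disjunction of the first `k` formulas. -/
def dsj (ψ : ℕ → L.Formula (ℕ ⊕ ℕ)) : ℕ → L.Formula (ℕ ⊕ ℕ)
  | 0 => ⊥
  | k + 1 => orr (dsj ψ k) (ψ k)

theorem dsj_qf (ψ : ℕ → L.Formula (ℕ ⊕ ℕ)) (h : ∀ i, (ψ i).IsQF) (k : ℕ) :
    (dsj ψ k).IsQF := by
  induction k with
  | zero => exact BoundedFormula.isQF_bot
  | succ k ih => exact orr_qf ih (h k)

theorem dsj_E (ψ : ℕ → L.Formula (ℕ ⊕ ℕ)) (k : ℕ) (M : Type max u v) [L.Structure M] [Nonempty M] :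
    E (dsj ψ k) M ↔ ∃ i < k, E (ψ i) M := by
  induction k with
  | zero =>
    simp only [dsj, E, Formula.realize_bot, not_lt_zero, false_and, exists_false, iff_false]
    rintro ⟨x, hx⟩
    exact hx x
  | succ k ih =>
    rw [dsj, orr_E, ih]
    constructor
    · rintro (⟨i, hi, h⟩ | h)
      · exact ⟨i, by omega, h⟩
      · exact ⟨k, by omega, h⟩
    · rintro ⟨i, hi, h⟩
      rcases Nat.lt_succ_iff_lt_or_eq.1 hi with h' | rfl
      · exact Or.inl ⟨i, h', h⟩
      · exact Or.inr h

theorem E_los {M : ℕ → Type max u v} [∀ i, L.Structure (M i)] [∀ i, Nonempty (M i)]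
    (ψ : L.Formula (ℕ ⊕ ℕ)) (h : ψ.IsQF) :
    E ψ ((U : Filter ℕ).Product M) ↔ ∀ᶠ i in (U : Filter ℕ), E ψ (M i) := by
  obtain ⟨B, n, β, -, hβ⟩ := E_sigma2 ψ h
  simp only [hβ]
  exact Ultraproduct.sentence_realize _

theorem step1 [Countable L.Symbols] (φ : L.Sentence) (hφ : PSCf φ) (M : Type max u v)
    [L.Structure M] [Nonempty M] (hM : M ⊨ φ) :
    ∃ ψ : L.Formula (ℕ ⊕ ℕ), ψ.IsQF ∧ E ψ M ∧
      ∀ (N : Type max u v) [L.Structure N] [Nonempty N], E ψ N → N ⊨ φ := by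
  by_contra H
  push Not at H
  let M' : Type max u v := (U : Filter ℕ).Product (fun _ : ℕ => M)
  have hM' : M' ⊨ φ := (Ultraproduct.sentence_realize φ).2 (Filter.Eventually.of_forall fun _ => hM)
  obtain ⟨C, hC, hcore⟩ := hφ M' hM'
  obtain ⟨c, hc⟩ : ∃ c : ℕ → M', C ⊆ Set.range c := by
    obtain ⟨c, hc⟩ := (hC.countable.insert (Classical.arbitrary M')).exists_eq_range
      (Set.insert_nonempty _ _)
    exact ⟨c, hc ▸ Set.subset_insert _ _⟩
  let Ψ := {ψ : L.Formula (ℕ ⊕ ℕ) // ψ.IsQF ∧ ∀ w : ℕ → M', ψ.Realize (Sum.elim c w)}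
  have : Nonempty Ψ := ⟨⟨⊤, BoundedFormula.IsQF.top, fun w => Formula.realize_top.2 trivial⟩⟩
  obtain ⟨p, hp⟩ := exists_surjective_nat Ψ
  have hN : ∀ k, ∃ (N : Type max u v) (_ : L.Structure N) (_ : Nonempty N),
      E (cnj (fun i => (p i).1) k) N ∧ ¬ N ⊨ φ := by
    intro k
    have hq := cnj_qf (fun i => (p i).1) (fun i => (p i).2.1) k
    suffices hh : E (cnj (fun i => (p i).1) k) M by
      obtain ⟨N, h1, h2, h3⟩ := H _ hq hh
      exact ⟨N, h1, h2, h3⟩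
    have : E (cnj (fun i => (p i).1) k) M' := ⟨c, fun w => (cnj_realize _ _ _).2 fun i _ =>
      (p i).2.2 w⟩
    rw [E_los _ hq] at this
    exact this.exists.choose_spec
  choose N hS hNe hE hnφ using hN
  choose d hd using hE
  let N' : Type max u v := (U : Filter ℕ).Product N
  have hN' : ¬ N' ⊨ φ := by
    intro h
    have := (Ultraproduct.sentence_realize φ).1 h
    exact this.exists.elim fun i hi => hnφ i hi
  let d' : ℕ → N' := fun b => mkU (fun i => d i b)
  have hd' : ∀ ψ : L.Formula (ℕ ⊕ ℕ), ψ.IsQF → (∀ w : ℕ → M', ψ.Realize (Sum.elim c w)) →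
      ∀ w : ℕ → N', ψ.Realize (Sum.elim d' w) := by
    intro ψ hψ h w
    obtain ⟨k, hk⟩ := hp ⟨ψ, hψ, h⟩
    obtain ⟨w, rfl⟩ := prod_lift w
    refine (los ψ (fun b i => d i b) w).2 ?_
    filter_upwards [ev_ge (k + 1)] with i hi
    have := (cnj_realize _ _ _).1 (hd i fun b => w b i) k (by omega)
    rw [hk] at this
    exact this
  obtain ⟨S, hS1, hS2⟩ := exists_countable (L := L) N' d'
  have hSφ : ¬ S ⊨ φ := by rwa [S.realize_sentence]
  let s : ℕ → S := fun b => ⟨d' b, hS1 ⟨b, rfl⟩⟩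
  have : Nonempty S := ⟨s 0⟩
  obtain ⟨e, he⟩ := exists_surjective_nat S
  have hs : ∀ ψ : L.Formula (ℕ ⊕ ℕ), ψ.IsQF → (∀ w : ℕ → M', ψ.Realize (Sum.elim c w)) →
      ψ.Realize (Sum.elim s e) := by
    intro ψ hψ h
    rw [← S.subtype.map_formula]
    have := hd' ψ hψ h (fun b => (e b : N'))
    convert this using 1
    funext b
    cases b <;> rfl
  let D := {ψ : L.Formula (ℕ ⊕ ℕ) // ψ.IsQF ∧ ψ.Realize (Sum.elim s e)}
  have : Nonempty D := ⟨⟨⊤, BoundedFormula.IsQF.top, Formula.realize_top.2 trivial⟩⟩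
  obtain ⟨q, hq⟩ := exists_surjective_nat D
  obtain ⟨w, hw⟩ := saturation (fun i => (q i).1) c (by
    intro k
    by_contra hn
    push Not at hn
    have hqf := cnj_qf (fun i => (q i).1) (fun i => (q i).2.1) k
    exact hs (cnj (fun i => (q i).1) k).not hqf.not hn
      ((cnj_realize _ _ _).2 fun i _ => (q i).2.2))
  obtain ⟨f, hf⟩ := embed (Sum.elim s e) (Sum.elim c w)
    (fun a => (he a).elim fun i hi => ⟨Sum.inr i, hi⟩) (by
      intro ψ hψ h
      obtain ⟨k, hk⟩ := hq ⟨ψ, hψ, h⟩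
      have := hw k
      rw [hk] at this
      exact this)
  have := hcore f.toHom.range (by
    intro x hx
    obtain ⟨b, rfl⟩ := hc hx
    exact ⟨s b, hf (Sum.inl b)⟩) ⟨⟨f (s 0), s 0, rfl⟩⟩
  exact hSφ ((StrongHomClass.realize_sentence f.equivRange φ).2 this)

theorem hard [Countable L.Symbols] (φ : L.Sentence) (hφ : PSCf φ) :
    ∃ ψ : L.Formula (ℕ ⊕ ℕ), ψ.IsQF ∧
      ∀ (N : Type max u v) [L.Structure N] [Nonempty N], N ⊨ φ ↔ E ψ N := by
  by_contra H
  push Not at H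
  let Ψ := {ψ : L.Formula (ℕ ⊕ ℕ) // ψ.IsQF ∧
    ∀ (N : Type max u v) [L.Structure N] [Nonempty N], E ψ N → N ⊨ φ}
  have : Nonempty Ψ := ⟨⟨⊥, BoundedFormula.isQF_bot, fun N _ _ h =>
    (((dsj_E (L := L) (fun _ => ⊥) 0 N).1 h).elim fun i hi => absurd hi.1 (by omega))⟩⟩
  obtain ⟨p, hp⟩ := exists_surjective_nat Ψ
  have hN : ∀ k, ∃ (N : Type max u v) (_ : L.Structure N) (_ : Nonempty N),
      N ⊨ φ ∧ ¬ E (dsj (fun i => (p i).1) k) N := by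
    intro k
    obtain ⟨N, h1, h2, h⟩ := H _ (dsj_qf (fun i => (p i).1) (fun i => (p i).2.1) k)
    refine ⟨N, h1, h2, ?_⟩
    rcases h with h | h
    · exact h
    · obtain ⟨i, -, hi⟩ := (dsj_E _ _ _).1 h.2
      exact absurd ((p i).2.2 N hi) h.1
  choose N hS hNe h1 h2 using hN
  obtain ⟨ψ, hψ, hE, hi⟩ := step1 φ hφ ((U : Filter ℕ).Product N)
    ((Ultraproduct.sentence_realize φ).2 (Filter.Eventually.of_forall h1))
  obtain ⟨k, hk⟩ := hp ⟨ψ, hψ, hi⟩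
  rw [E_los ψ hψ] at hE
  obtain ⟨i, hi, hki⟩ := (hE.and (ev_ge (k + 1))).exists
  refine h2 i ((dsj_E _ _ _).2 ⟨k, by omega, ?_⟩)
  rw [hk]
  exact hi

end aux

/-- An FO sentence `φ` (over an arbitrary finite vocabulary) is preserved under substructures
modulo a finite core iff `φ` is logically equivalent to a Σ⁰₂ sentence
`∃x₁…x_B ∀y₁…y_n β` with `β` quantifier-free. -/
theorem statement0 [Finite L.Symbols] (φ : L.Sentence) :
    PSCf φ ↔
      ∃ (B n : ℕ) (β : L.BoundedFormula Empty (B + n)), β.IsQF ∧ Equiv φ (sigma2 B n β) := by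
  constructor
  · intro h
    obtain ⟨ψ, hψ, hE⟩ := hard φ h
    obtain ⟨B, n, β, hβ, hs⟩ := E_sigma2 ψ hψ
    exact ⟨B, n, β, hβ, fun M _ _ => (hE M).trans (hs M)⟩
  · rintro ⟨B, n, β, hβ, h⟩
    exact easy φ B n β hβ h

end Stmt
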